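/- Let μ' be a nonzero finite Borel measure on the circle 𝕋 = ℝ/ℤ that is quasi-invariant under every rotation, i.e., for every t ∈ 𝕋 the translated measure μ' + t has exactly the same null sets as μ'. Then μ' is equivalent (mutually absolutely continuous) to Haar (Lebesgue) measure on 𝕋. -/

import Mathlib

open MeasureTheory

instance : Fact ((0 : ℝ) < 1) := ⟨one_pos⟩

/-- Averaging the right translates of `μ` against a left-invariant measure `ν` gives
`μ univ • ν`. -/
theorem lintegral_map_add_right_apply {G : Type*} [AddGroup G] [MeasurableSpace G]
    [MeasurableAdd₂ G] (μ ν : Measure G) [SFinite μ] [SFinite ν] [ν.IsAddLeftInvariant]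
    {s : Set G} (hs : MeasurableSet s) :
    ∫⁻ t, μ.map (fun x => x + t) s ∂ν = ν s * μ Set.univ := by
  have hpre : MeasurableSet ((fun p : G × G => p.1 + p.2) ⁻¹' s) := measurable_add hs
  calc ∫⁻ t, μ.map (fun x => x + t) s ∂ν
      = (μ.prod ν) ((fun p : G × G => p.1 + p.2) ⁻¹' s) := by
        rw [Measure.prod_apply_symm hpre]
        exact lintegral_congr fun t => Measure.map_apply (measurable_add_const t) hs
    _ = ∫⁻ x, ν ((fun t => x + t) ⁻¹' s) ∂μ := Measure.prod_apply hpre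
    _ = ν s * μ Set.univ := by simp only [measure_preimage_add, lintegral_const]

/-- A nonzero finite Borel measure on the circle ℝ/ℤ which is quasi-invariant under all
rotations is equivalent to Haar (Lebesgue) measure. -/
theorem quasiinvariant_measure_equivalent_haar (μ' : Measure (AddCircle (1 : ℝ)))
    [IsFiniteMeasure μ'] (hne : μ' ≠ 0)
    (hqi : ∀ t : AddCircle (1 : ℝ),
      μ'.map (fun x => x + t) ≪ μ' ∧ μ' ≪ μ'.map (fun x => x + t)) :
    μ' ≪ (volume : Measure (AddCircle (1 : ℝ))) ∧
      (volume : Measure (AddCircle (1 : ℝ))) ≪ μ' := by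
  refine ⟨.mk fun s hs h0 => ?_, .mk fun s hs h0 => ?_⟩ <;>
    have key := lintegral_map_add_right_apply μ' (volume : Measure (AddCircle (1 : ℝ))) hs
  · have hmeas : Measurable fun t => μ'.map (fun x => x + t) s := by
      rw [funext fun t => Measure.map_apply (measurable_add_const t) hs]
      exact measurable_measure_prodMk_right (measurable_add hs)
    rw [h0, zero_mul, lintegral_eq_zero_iff hmeas] at key
    obtain ⟨t, ht⟩ := key.exists
    exact (hqi t).2 ht
  · rw [lintegral_congr fun t => (hqi t).1 h0, lintegral_zero] at key
    exact (mul_eq_zero.1 key.symm).resolve_right (Measure.measure_univ_ne_zero.2 hne)
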